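/- With the same setup (finite Gaussian mixtures p = Σ_{n∈I₁} αₙ N(·; μₙ, Pₙ) and q = Σ_{m∈I₂} βₘ N(·; mₘ, Sₘ) with symmetric positive-definite covariances, and J(αₙ) = ISD(p‖q) as a function of the single weight αₙ with all other weights fixed), the second derivative of J is constant and equals 2 N(μₙ; μₙ, 2Pₙ) = 2 (2π)^{-d/2} (det(2Pₙ))^{-1/2}, which is strictly positive; in particular J is a strictly convex quadratic function of αₙ. -/

import Mathlib

open MeasureTheory Real Matrix Finset

/-- The multivariate Gaussian density
`N(x; μ, Σ) = ((2π)^d det Σ)^{-1/2} exp(-(1/2)(x-μ)ᵀ Σ⁻¹ (x-μ))` on `ℝ^d`. -/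
noncomputable def gaussPDF (d : ℕ) (μ : Fin d → ℝ) (S : Matrix (Fin d) (Fin d) ℝ)
    (x : Fin d → ℝ) : ℝ :=
  (Real.sqrt ((2 * Real.pi) ^ d * S.det))⁻¹ *
    Real.exp (-(1 / 2) * ((x - μ) ⬝ᵥ (S⁻¹ *ᵥ (x - μ))))

/-- `J(αₙ) = ISD(p‖q)` regarded as a function of the single mixture weight `αₙ`
of the `n`-th component of `p`, all other weights held fixed. -/
noncomputable def isdWeightFun (d : ℕ) (I₁ I₂ : Type*)
    [Fintype I₁] [Fintype I₂] [DecidableEq I₁]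
    (α : I₁ → ℝ) (β : I₂ → ℝ)
    (μ : I₁ → Fin d → ℝ) (m : I₂ → Fin d → ℝ)
    (P : I₁ → Matrix (Fin d) (Fin d) ℝ) (S : I₂ → Matrix (Fin d) (Fin d) ℝ)
    (n : I₁) (t : ℝ) : ℝ :=
  ∫ x : Fin d → ℝ,
    ((∑ n', Function.update α n t n' * gaussPDF d (μ n') (P n') x)
      - ∑ m', β m' * gaussPDF d (m m') (S m') x) ^ 2

open scoped MatrixOrder in
theorem Matrix.PosDef.exists_transpose_mul_self {ι : Type*} [Fintype ι] [DecidableEq ι]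
    {Q : Matrix ι ι ℝ} (hQ : Q.PosDef) : ∃ A : Matrix ι ι ℝ, A.det ≠ 0 ∧ Q = Aᵀ * A := by
  obtain ⟨A, hA⟩ := CStarAlgebra.nonneg_iff_eq_star_mul_self.mp hQ.posSemidef.nonneg
  rw [star_eq_conjTranspose, conjTranspose_eq_transpose_of_trivial] at hA
  refine ⟨A, fun h => hQ.det_pos.ne' ?_, hA⟩
  rw [hA, det_mul, h, mul_zero]

theorem integrable_exp_neg_dotProduct_self (ι : Type*) [Fintype ι] :
    Integrable (fun y : ι → ℝ => exp (-(y ⬝ᵥ y))) := by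
  have h : Integrable (fun x : ℝ => exp (-x ^ 2)) := by
    simpa using integrable_exp_neg_mul_sq one_pos
  have hprod := Integrable.fintype_prod (ι := ι) (μ := fun _ => volume) fun _ => h
  rw [← volume_pi] at hprod
  simpa [← exp_sum, dotProduct, pow_two] using hprod

theorem integral_exp_neg_dotProduct_self (ι : Type*) [Fintype ι] :
    ∫ y : ι → ℝ, exp (-(y ⬝ᵥ y)) = √π ^ Fintype.card ι := by
  have h := integral_fintype_prod_volume_eq_pow (ι := ι) fun x : ℝ => exp (-1 * x ^ 2)
  rw [integral_gaussian] at h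
  simpa [← exp_sum, dotProduct, pow_two] using h

section QuadraticForm

variable {ι : Type*} [Fintype ι]

theorem Matrix.dotProduct_transpose_mul_self_mulVec (A : Matrix ι ι ℝ) (x : ι → ℝ) :
    x ⬝ᵥ ((Aᵀ * A) *ᵥ x) = (A *ᵥ x) ⬝ᵥ (A *ᵥ x) := by
  rw [← mulVec_mulVec, dotProduct_mulVec, vecMul_transpose]

variable [DecidableEq ι]

theorem Matrix.integrable_comp_mulVec {A : Matrix ι ι ℝ} (hA : A.det ≠ 0)
    {f : (ι → ℝ) → ℝ} (hf : Integrable f) : Integrable fun x => f (A *ᵥ x) := by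
  have hmap := Real.map_matrix_volume_pi_eq_smul_volume_pi hA
  have hc : Continuous (toLin' A) := LinearMap.continuous_of_finiteDimensional _
  have h : Integrable f (Measure.map (toLin' A) volume) := by
    rw [hmap]
    exact hf.smul_measure ENNReal.ofReal_ne_top
  exact h.comp_measurable hc.measurable

theorem Matrix.integral_comp_mulVec {A : Matrix ι ι ℝ} (hA : A.det ≠ 0)
    {f : (ι → ℝ) → ℝ} (hf : Continuous f) :
    ∫ x, f (A *ᵥ x) = |A.det|⁻¹ * ∫ x, f x := by
  have hc : Continuous (toLin' A) := LinearMap.continuous_of_finiteDimensional _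
  have h := integral_map (μ := volume) hc.measurable.aemeasurable
    (f := f) hf.aestronglyMeasurable
  rw [Real.map_matrix_volume_pi_eq_smul_volume_pi hA, integral_smul_measure,
    ENNReal.toReal_ofReal (abs_nonneg _), abs_inv] at h
  simpa using h.symm

theorem Matrix.PosDef.integrable_exp_neg {Q : Matrix ι ι ℝ} (hQ : Q.PosDef) :
    Integrable fun x : ι → ℝ => exp (-(x ⬝ᵥ (Q *ᵥ x))) := by
  obtain ⟨A, hA, rfl⟩ := hQ.exists_transpose_mul_self
  simp_rw [dotProduct_transpose_mul_self_mulVec]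
  exact integrable_comp_mulVec hA (integrable_exp_neg_dotProduct_self ι)

theorem Matrix.PosDef.integral_exp_neg {Q : Matrix ι ι ℝ} (hQ : Q.PosDef) :
    ∫ x : ι → ℝ, exp (-(x ⬝ᵥ (Q *ᵥ x))) = √(π ^ Fintype.card ι * Q.det⁻¹) := by
  obtain ⟨A, hA, rfl⟩ := hQ.exists_transpose_mul_self
  simp_rw [dotProduct_transpose_mul_self_mulVec]
  rw [integral_comp_mulVec (f := fun y => exp (-(y ⬝ᵥ y))) hA (by fun_prop),
    integral_exp_neg_dotProduct_self, det_mul, det_transpose, sqrt_mul (by positivity),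
    sqrt_inv, sqrt_mul_self_eq_abs, mul_comm]
  congr 1
  rw [eq_comm, sqrt_eq_iff_mul_self_eq (by positivity) (by positivity), ← mul_pow,
    mul_self_sqrt pi_pos.le]

end QuadraticForm

section GaussPDF

variable {d : ℕ} {S : Matrix (Fin d) (Fin d) ℝ}

theorem continuous_gaussPDF (μ : Fin d → ℝ) (S : Matrix (Fin d) (Fin d) ℝ) :
    Continuous (gaussPDF d μ S) := by
  unfold gaussPDF
  fun_prop

theorem gaussPDF_sq (hS : 0 < S.det) (μ x : Fin d → ℝ) :
    gaussPDF d μ S x ^ 2 =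
      ((2 * π) ^ d * S.det)⁻¹ * exp (-((x - μ) ⬝ᵥ (S⁻¹ *ᵥ (x - μ)))) := by
  rw [gaussPDF, mul_pow, inv_pow, sq_sqrt (by positivity), ← exp_nat_mul]
  congr 2
  push_cast
  ring

theorem memLp_gaussPDF (hS : S.PosDef) (μ : Fin d → ℝ) : MemLp (gaussPDF d μ S) 2 := by
  rw [memLp_two_iff_integrable_sq (continuous_gaussPDF μ S).aestronglyMeasurable]
  simp_rw [gaussPDF_sq hS.det_pos]
  exact (hS.inv.integrable_exp_neg.comp_sub_right μ).const_mul _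

theorem gaussPDF_self (μ : Fin d → ℝ) (S : Matrix (Fin d) (Fin d) ℝ) :
    gaussPDF d μ S μ = (√((2 * π) ^ d * S.det))⁻¹ := by
  simp [gaussPDF]

theorem gaussPDF_self_pos (hS : 0 < S.det) (μ : Fin d → ℝ) : 0 < gaussPDF d μ S μ := by
  rw [gaussPDF_self]
  positivity

theorem gaussPDF_self_eq_rpow (hS : 0 < S.det) (μ : Fin d → ℝ) :
    gaussPDF d μ S μ = (2 * π) ^ (-(d : ℝ) / 2) * S.det ^ (-(1 / 2 : ℝ)) := by
  rw [gaussPDF_self, sqrt_eq_rpow, ← rpow_neg (by positivity), mul_rpow (by positivity) hS.le,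
    ← rpow_natCast, ← rpow_mul (by positivity)]
  congr 2
  ring

theorem integral_gaussPDF_sq (hS : S.PosDef) (μ : Fin d → ℝ) :
    ∫ x, gaussPDF d μ S x ^ 2 = gaussPDF d μ ((2 : ℝ) • S) μ := by
  have hdet := hS.det_pos
  simp_rw [gaussPDF_sq hdet]
  rw [integral_const_mul,
    integral_sub_right_eq_self (fun x => exp (-(x ⬝ᵥ (S⁻¹ *ᵥ x)))) μ,
    hS.inv.integral_exp_neg, gaussPDF_self, det_smul, det_nonsing_inv, Ring.inverse_eq_inv',
    inv_inv, Fintype.card_fin]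
  have h : (2 * π) ^ d * (2 ^ d * S.det) = (2 ^ d) ^ 2 * (π ^ d * S.det) := by
    rw [mul_pow]
    ring
  have hpos : 0 < π ^ d * S.det := by positivity
  rw [h, sqrt_mul (x := (2 ^ d) ^ 2) (by positivity), sqrt_sq (by positivity), mul_pow, mul_assoc]
  have hs := sq_sqrt hpos.le
  have hs0 := sqrt_pos.2 hpos
  generalize √(π ^ d * S.det) = s at *
  rw [← hs]
  field_simp

end GaussPDF

theorem integral_sq_const_mul_add {X : Type*} [MeasurableSpace X] {ν : Measure X} {f g : X → ℝ}
    (hf : MemLp f 2 ν) (hg : MemLp g 2 ν) (t : ℝ) :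
    ∫ x, (t * f x + g x) ^ 2 ∂ν =
      (∫ x, f x ^ 2 ∂ν) * t ^ 2 + (2 * ∫ x, f x * g x ∂ν) * t + ∫ x, g x ^ 2 ∂ν := by
  have h : ∀ x, (t * f x + g x) ^ 2 = t ^ 2 * f x ^ 2 + 2 * t * (f x * g x) + g x ^ 2 :=
    fun x => by ring
  have hff := hf.integrable_sq.const_mul (t ^ 2)
  have hfg := (hf.integrable_mul hg).const_mul (2 * t)
  simp only [Pi.mul_apply] at hfg
  simp_rw [h]
  rw [integral_add (by exact hff.add hfg) hg.integrable_sq, integral_add hff hfg, integral_const_mul,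
    integral_const_mul]
  ring

theorem deriv_deriv_quadratic (a b c x : ℝ) :
    deriv (deriv fun t : ℝ => a * t ^ 2 + b * t + c) x = 2 * a := by
  have h : (deriv fun t : ℝ => a * t ^ 2 + b * t + c) = fun t => 2 * a * t + b := by
    ext t
    have ht := (((hasDerivAt_pow 2 t).const_mul a).fun_add
      ((hasDerivAt_id' t).const_mul b)).add_const c
    rw [ht.deriv]
    push_cast
    ring
  rw [h]
  simp

theorem strictConvexOn_quadratic {a : ℝ} (ha : 0 < a) (b c : ℝ) :
    StrictConvexOn ℝ Set.univ fun t : ℝ => a * t ^ 2 + b * t + c := by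
  refine ⟨convex_univ, fun x _ y _ hxy u v hu hv huv => ?_⟩
  obtain rfl : v = 1 - u := by linarith
  have h : 0 < a * (u * (1 - u) * (x - y) ^ 2) := by
    have := sq_pos_of_ne_zero (sub_ne_zero.2 hxy)
    positivity
  simp only [smul_eq_mul]
  linarith [h]

theorem isdWeightFun_eq_quadratic (d : ℕ) (I₁ I₂ : Type*)
    [Fintype I₁] [Fintype I₂] [DecidableEq I₁]
    (α : I₁ → ℝ) (β : I₂ → ℝ)
    (μ : I₁ → Fin d → ℝ) (m : I₂ → Fin d → ℝ)
    (P : I₁ → Matrix (Fin d) (Fin d) ℝ) (S : I₂ → Matrix (Fin d) (Fin d) ℝ)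
    (hP : ∀ n, (P n).PosDef) (hS : ∀ m', (S m').PosDef) (n : I₁) :
    ∃ b c : ℝ, isdWeightFun d I₁ I₂ α β μ m P S n =
      fun t => gaussPDF d (μ n) ((2 : ℝ) • P n) (μ n) * t ^ 2 + b * t + c := by
  let g : (Fin d → ℝ) → ℝ := fun x =>
    (∑ n' ∈ univ.erase n, α n' * gaussPDF d (μ n') (P n') x)
      - ∑ m', β m' * gaussPDF d (m m') (S m') x
  have hg : MemLp g 2 :=
    (memLp_finsetSum _ fun i _ => (memLp_gaussPDF (hP i) (μ i)).const_mul (α i)).sub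
      (memLp_finsetSum _ fun i _ => (memLp_gaussPDF (hS i) (m i)).const_mul (β i))
  refine ⟨2 * ∫ x, gaussPDF d (μ n) (P n) x * g x, ∫ x, g x ^ 2, funext fun t => ?_⟩
  rw [← integral_gaussPDF_sq (hP n),
    ← integral_sq_const_mul_add (memLp_gaussPDF (hP n) (μ n)) hg, isdWeightFun]
  congr! 3 with x
  rw [← add_sum_erase _ _ (mem_univ n), Function.update_self, add_sub_assoc]
  congr 2
  exact sum_congr rfl fun i hi => by rw [Function.update_of_ne (ne_of_mem_erase hi)]

/-- The second derivative of `J(αₙ) = ISD(p‖q)` (as a function of the single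
weight `αₙ`) is constant and equals `2 N(μₙ; μₙ, 2Pₙ) = 2 (2π)^{-d/2} (det(2Pₙ))^{-1/2} > 0`;
in particular `J` is a strictly convex quadratic function of `αₙ`. -/
theorem second_deriv_isd_single_weight (d : ℕ) (I₁ I₂ : Type*)
    [Fintype I₁] [Fintype I₂] [DecidableEq I₁]
    (α : I₁ → ℝ) (β : I₂ → ℝ)
    (μ : I₁ → Fin d → ℝ) (m : I₂ → Fin d → ℝ)
    (P : I₁ → Matrix (Fin d) (Fin d) ℝ) (S : I₂ → Matrix (Fin d) (Fin d) ℝ)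
    (hP : ∀ n, (P n).PosDef) (hS : ∀ m', (S m').PosDef) (n : I₁) :
    (∀ a : ℝ, deriv (deriv (isdWeightFun d I₁ I₂ α β μ m P S n)) a
        = 2 * gaussPDF d (μ n) ((2 : ℝ) • P n) (μ n))
      ∧ 2 * gaussPDF d (μ n) ((2 : ℝ) • P n) (μ n)
          = 2 * (2 * Real.pi) ^ (-(d : ℝ) / 2) * (((2 : ℝ) • P n).det) ^ (-(1 / 2 : ℝ))
      ∧ 0 < 2 * gaussPDF d (μ n) ((2 : ℝ) • P n) (μ n)
      ∧ StrictConvexOn ℝ Set.univ (isdWeightFun d I₁ I₂ α β μ m P S n)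
      ∧ ∃ c₂ c₁ c₀ : ℝ, 0 < c₂ ∧
          ∀ t : ℝ, isdWeightFun d I₁ I₂ α β μ m P S n t = c₂ * t ^ 2 + c₁ * t + c₀ := by
  have hdet : 0 < ((2 : ℝ) • P n).det := ((hP n).smul two_pos).det_pos
  have hpos := gaussPDF_self_pos hdet (μ n)
  obtain ⟨b, c, h⟩ := isdWeightFun_eq_quadratic d I₁ I₂ α β μ m P S hP hS n
  rw [h]
  refine ⟨deriv_deriv_quadratic _ b c, ?_, by positivity, strictConvexOn_quadratic hpos b c,
    _, b, c, hpos, fun _ => rfl⟩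
  rw [gaussPDF_self_eq_rpow hdet, mul_assoc]
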